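/- Let λ be a Lévy measure on (0,∞) satisfying Condition (E). Suppose there are α ∈ (0, 1+2/d) and a slowly varying function ℓ such that λ̄(r) = ℓ(r) r^{-α} for all r ≥ 1. Then η̄(r) ~ ℓ(r) r^{-α} · D^{1+2/d-α} / (d π κ α^{d/2} (1 + 2/d − α)) as r → ∞. -/

import Mathlib

open MeasureTheory Real Filter Set
open scoped ENNReal Topology

noncomputable section

/-- The heat kernel on `ℝ^d` with diffusion constant `κ`. -/
def heatKernel (d : ℕ) (κ : ℝ) (s : ℝ) (x : EuclideanSpace ℝ (Fin d)) : ℝ :=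
  (2 * π * κ * s) ^ (-(d : ℝ) / 2) * Real.exp (-‖x‖ ^ 2 / (2 * κ * s))

/-- A Lévy measure on `(0,∞)`: a nonzero Borel measure carried by `(0,∞)`
with `∫ min(1, z²) λ(dz) < ∞`. -/
def IsLevyMeasure (lam : Measure ℝ) : Prop :=
  lam ≠ 0 ∧ lam (Set.Iic 0) = 0 ∧
    ∫⁻ z in Set.Ioi (0 : ℝ), ENNReal.ofReal (min 1 (z ^ 2)) ∂lam < ⊤

/-- `η̄(r) = (Leb ⊗ Leb ⊗ λ)({(s,y,z) ∈ (0,t] × ℝ^d × (0,∞) : g(s,y) z > r})`. -/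
def etaBar (d : ℕ) (κ t : ℝ) (lam : Measure ℝ) (r : ℝ) : ℝ≥0∞ :=
  (volume.prod (volume.prod lam))
    {p : ℝ × (EuclideanSpace ℝ (Fin d)) × ℝ |
      p.1 ∈ Set.Ioc (0 : ℝ) t ∧ p.2.2 ∈ Set.Ioi (0 : ℝ) ∧
        r < heatKernel d κ p.1 p.2.1 * p.2.2}

/-- `η̄₀(r)`, the analogue of `η̄` with the restriction `|y| ≤ 1/2`. -/
def etaBar0 (d : ℕ) (κ t : ℝ) (lam : Measure ℝ) (r : ℝ) : ℝ≥0∞ :=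
  (volume.prod (volume.prod lam))
    {p : ℝ × (EuclideanSpace ℝ (Fin d)) × ℝ |
      p.1 ∈ Set.Ioc (0 : ℝ) t ∧ p.2.2 ∈ Set.Ioi (0 : ℝ) ∧ ‖p.2.1‖ ≤ 1 / 2 ∧
        r < heatKernel d κ p.1 p.2.1 * p.2.2}

/-- `η̄_A(r)`, where the heat kernel is evaluated at `dist(y, A)`. -/
def etaBarA (d : ℕ) (κ t : ℝ) (lam : Measure ℝ)
    (A : Set (EuclideanSpace ℝ (Fin d))) (r : ℝ) : ℝ≥0∞ :=
  (volume.prod (volume.prod lam))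
    {p : ℝ × (EuclideanSpace ℝ (Fin d)) × ℝ |
      p.1 ∈ Set.Ioc (0 : ℝ) t ∧ p.2.2 ∈ Set.Ioi (0 : ℝ) ∧
        r < (2 * π * κ * p.1) ^ (-(d : ℝ) / 2) *
            Real.exp (-(Metric.infDist p.2.1 A) ^ 2 / (2 * κ * p.1)) * p.2.2}

/-- `τ̄(r) = (Leb ⊗ λ)({(s,z) ∈ (0,t] × (0,∞) : (2πκs)^{-d/2} z > r})`. -/
def tauBar (d : ℕ) (κ t : ℝ) (lam : Measure ℝ) (r : ℝ) : ℝ≥0∞ :=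
  (volume.prod lam)
    {p : ℝ × ℝ | p.1 ∈ Set.Ioc (0 : ℝ) t ∧ p.2 ∈ Set.Ioi (0 : ℝ) ∧
      r < (2 * π * κ * p.1) ^ (-(d : ℝ) / 2) * p.2}

/-- The truncated moment `M_γ(x) = ∫_{(0,x]} z^γ λ(dz)`. -/
def Mgamma (lam : Measure ℝ) (γ x : ℝ) : ℝ≥0∞ :=
  ∫⁻ z in Set.Ioc (0 : ℝ) x, ENNReal.ofReal (z ^ γ) ∂lam

/-- A measurable function, positive on `[1,∞)`, is slowly varying at infinity if
`ℓ(cx)/ℓ(x) → 1` as `x → ∞` for every `c > 0`. -/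
def SlowlyVarying (ℓ : ℝ → ℝ) : Prop :=
  Measurable ℓ ∧ (∀ x ≥ (1 : ℝ), 0 < ℓ x) ∧
    ∀ c > (0 : ℝ), Tendsto (fun x => ℓ (c * x) / ℓ x) atTop (𝓝 1)

/-- Regular variation at infinity with index `-α`: `f` is eventually positive and
`f(cr)/f(r) → c^{-α}` as `r → ∞` for every `c > 0`. -/
def RegVaryNeg (f : ℝ → ℝ) (α : ℝ) : Prop :=
  (∀ᶠ r in atTop, 0 < f r) ∧
    ∀ c > (0 : ℝ), Tendsto (fun r => f (c * r) / f r) atTop (𝓝 (c ^ (-α)))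

/-- Condition (E): the necessary and sufficient condition for existence of the solution. -/
def ConditionE (d : ℕ) (lam : Measure ℝ) : Prop :=
  (∫⁻ z in Set.Ioi (1 : ℝ), ENNReal.ofReal (Real.log z ^ ((d : ℝ) / 2)) ∂lam < ⊤) ∧
  (d = 1 → ∫⁻ z in Set.Ioc (0 : ℝ) 1, ENNReal.ofReal (z ^ 2) ∂lam < ⊤) ∧
  (d = 2 → ∫⁻ z in Set.Ioc (0 : ℝ) 1, ENNReal.ofReal (z ^ 2 * |Real.log z|) ∂lam < ⊤) ∧
  (3 ≤ d → ∫⁻ z in Set.Ioc (0 : ℝ) 1, ENNReal.ofReal (z ^ (1 + 2 / (d : ℝ))) ∂lam < ⊤)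

/-- Condition (F): `∫_{(0,1)} z^{2/d} λ(dz) < ∞` if `d ≠ 2`,
and `∫_{(0,1)} z |log z| λ(dz) < ∞` if `d = 2`. -/
def ConditionF (d : ℕ) (lam : Measure ℝ) : Prop :=
  (d ≠ 2 → ∫⁻ z in Set.Ioo (0 : ℝ) 1, ENNReal.ofReal (z ^ ((2 : ℝ) / d)) ∂lam < ⊤) ∧
  (d = 2 → ∫⁻ z in Set.Ioo (0 : ℝ) 1, ENNReal.ofReal (z * |Real.log z|) ∂lam < ⊤)

theorem potter_bound {F : ℝ → ℝ} {α δ : ℝ} (hδ : 0 < δ) (hδα : δ < α)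
    (hanti : AntitoneOn F (Ici 1)) (hpos : ∀ r ≥ (1 : ℝ), 0 < F r)
    (hlim : Tendsto (fun r => F (2 * r) / F r) atTop (𝓝 (2 ^ (-α)))) :
    ∃ A ≥ (1 : ℝ), ∀ x ≥ A, ∀ y ≥ A,
      F y ≤ 2 ^ (α + δ) * F x * ((x / y) ^ (α - δ) + (x / y) ^ (α + δ)) := by
  have hlow : (2 : ℝ) ^ (-(α + δ)) < 2 ^ (-α) :=
    Real.rpow_lt_rpow_of_exponent_lt (by norm_num) (by linarith)
  have hupp : (2 : ℝ) ^ (-α) < 2 ^ (-(α - δ)) :=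
    Real.rpow_lt_rpow_of_exponent_lt (by norm_num) (by linarith)
  obtain ⟨A, hA⟩ := eventually_atTop.1 (((hlim.eventually_const_lt hlow).and
    (hlim.eventually_lt_const hupp)).and (eventually_ge_atTop (1 : ℝ)))
  have hA1 : 1 ≤ A := (hA A le_rfl).2
  have hpow : ∀ x ≥ A, ∀ n : ℕ, F (2 ^ n * x) ≤ ((2 : ℝ) ^ n) ^ (-(α - δ)) * F x ∧
      ((2 : ℝ) ^ n) ^ (-(α + δ)) * F x ≤ F (2 ^ n * x) := by
    intro x hx n
    induction n with
    | zero => simp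
    | succ n ih =>
      have hn : (1 : ℝ) ≤ 2 ^ n := one_le_pow₀ (by norm_num)
      have hge : A ≤ 2 ^ n * x := by nlinarith
      have hF : 0 < F (2 ^ n * x) := hpos _ (hA1.trans hge)
      obtain ⟨⟨h1, h2⟩, -⟩ := hA _ hge
      rw [lt_div_iff₀ hF] at h1
      rw [div_lt_iff₀ hF] at h2
      have he : (2 : ℝ) ^ (n + 1) * x = 2 * (2 ^ n * x) := by ring
      have hm : ∀ p : ℝ, ((2 : ℝ) ^ (n + 1)) ^ p = 2 ^ p * (2 ^ n) ^ p := fun p => by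
        rw [pow_succ', Real.mul_rpow (by norm_num) (by positivity)]
      rw [he, hm, hm]
      constructor
      · refine h2.le.trans ?_
        rw [mul_assoc]
        exact mul_le_mul_of_nonneg_left ih.1 (by positivity)
      · refine le_trans ?_ h1.le
        rw [mul_assoc]
        exact mul_le_mul_of_nonneg_left ih.2 (by positivity)
  have hord : ∀ x ≥ A, ∀ y ≥ x, F y ≤ 2 ^ (α - δ) * (y / x) ^ (-(α - δ)) * F x ∧
      F x ≤ 2 ^ (α + δ) * (y / x) ^ (α + δ) * F y := by
    intro x hx y hy
    have hx0 : 0 < x := by linarith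
    have hy0 : 0 < y := by linarith
    have hq : 1 ≤ y / x := (one_le_div hx0).2 hy
    have hq0 : 0 < y / x := by positivity
    obtain ⟨n, hn1, hn2⟩ := exists_nat_pow_near hq (by norm_num : (1 : ℝ) < 2)
    have hn0 : (1 : ℝ) ≤ 2 ^ n := one_le_pow₀ (by norm_num)
    have hle : 2 ^ n * x ≤ y := (le_div_iff₀ hx0).1 hn1
    have hge : y ≤ 2 ^ (n + 1) * x := ((div_lt_iff₀ hx0).1 hn2).le
    have hFx := hpos x (hA1.trans hx)
    have hFy := hpos y (by linarith)
    have hxn : (1 : ℝ) ≤ 2 ^ n * x := by nlinarith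
    constructor
    · refine (hanti hxn (show (1 : ℝ) ≤ y by linarith) hle).trans
        (((hpow x hx n).1).trans ?_)
      refine mul_le_mul_of_nonneg_right ?_ hFx.le
      have h3 : (y / x / 2) ≤ 2 ^ n := by rw [pow_succ] at hn2; linarith
      calc ((2 : ℝ) ^ n) ^ (-(α - δ)) ≤ (y / x / 2) ^ (-(α - δ)) :=
            Real.rpow_le_rpow_of_nonpos (by positivity) h3 (by linarith)
        _ = _ := by
            rw [Real.div_rpow hq0.le (by norm_num), Real.rpow_neg (by norm_num : (0:ℝ) ≤ 2),
              div_inv_eq_mul, mul_comm]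
    · have h4 : F (2 ^ (n + 1) * x) ≤ F y :=
        hanti (show (1 : ℝ) ≤ y by linarith) (show (1 : ℝ) ≤ _ by linarith) hge
      have h5 := (hpow x hx (n + 1)).2.trans h4
      have h6 : ((2 : ℝ) ^ (n + 1)) ^ (α + δ) ≤ 2 ^ (α + δ) * (y / x) ^ (α + δ) := by
        rw [← Real.mul_rpow (by norm_num) hq0.le]
        refine Real.rpow_le_rpow (by positivity) ?_ (by linarith)
        rw [pow_succ]; linarith
      have h7 : 0 < ((2 : ℝ) ^ (n + 1)) ^ (α + δ) := by positivity
      rw [Real.rpow_neg (by positivity), inv_mul_le_iff₀ h7] at h5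
      exact h5.trans (mul_le_mul_of_nonneg_right h6 hFy.le)
  refine ⟨A, hA1, fun x hx y hy => ?_⟩
  have hx0 : 0 < x := by linarith
  have hy0 : 0 < y := by linarith
  have hFx := hpos x (hA1.trans hx)
  have hxy : 0 < x / y := by positivity
  have hp1 : 0 < (x / y) ^ (α - δ) := by positivity
  have hp2 : 0 < (x / y) ^ (α + δ) := by positivity
  rcases le_total x y with h | h
  · have h1 := (hord x hx y h).1
    rw [Real.rpow_neg (by positivity), ← Real.inv_rpow (by positivity), inv_div] at h1
    have h2 : (2 : ℝ) ^ (α - δ) ≤ 2 ^ (α + δ) :=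
      Real.rpow_le_rpow_of_exponent_le (by norm_num) (by linarith)
    calc F y ≤ 2 ^ (α - δ) * (x / y) ^ (α - δ) * F x := h1
      _ ≤ 2 ^ (α + δ) * ((x / y) ^ (α - δ) + (x / y) ^ (α + δ)) * F x := by
        gcongr
        linarith
      _ = _ := by ring
  · have h1 := (hord y hy x h).2
    calc F y ≤ 2 ^ (α + δ) * (x / y) ^ (α + δ) * F x := h1
      _ ≤ 2 ^ (α + δ) * ((x / y) ^ (α - δ) + (x / y) ^ (α + δ)) * F x := by
        gcongr
        linarith
      _ = _ := by ring

theorem measurable_measure_Ioi (lam : Measure ℝ) : Measurable fun x : ℝ => lam (Ioi x) :=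
  Antitone.measurable fun _ _ h => measure_mono (Ioi_subset_Ioi h)

theorem lintegral_measure_Ioi_div_le {X : Type*} [MeasurableSpace X] {μ : Measure X} [SFinite μ]
    {lam : Measure ℝ} [SFinite lam] (hlam0 : lam (Iic 0) = 0) {g : X → ℝ} (hg : Measurable g)
    {β C A r : ℝ} (hC : 0 ≤ C) (hA : 0 < A) (hr : 0 < r)
    (hμ : ∀ u > 0, μ {x | u < g x} ≤ ENNReal.ofReal (C * u ^ (-β))) :
    ∫⁻ x in {x | r / A < g x}, lam (Ioi (r / g x)) ∂μ ≤
      ENNReal.ofReal (C * r ^ (-β)) *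
        ∫⁻ z in Ioi (0 : ℝ), ENNReal.ofReal (min z A ^ β) ∂lam := by
  have hS : MeasurableSet {q : X × ℝ | r / g q.1 < q.2} :=
    measurableSet_lt ((measurable_const.div (hg.comp measurable_fst))) measurable_snd
  have hT : MeasurableSet {x | r / A < g x} := measurableSet_lt measurable_const hg
  have h0 : ∀ᵐ z ∂lam, z ∈ Ioi (0 : ℝ) := by
    rw [ae_iff]
    simpa [Iic] using hlam0
  have e1 : ∫⁻ x in {x | r / A < g x}, lam (Ioi (r / g x)) ∂μ =
      ∫⁻ z in Ioi (0 : ℝ), (μ.restrict {x | r / A < g x}) {x | r / g x < z} ∂lam := by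
    rw [Measure.restrict_eq_self_of_ae_mem h0]
    exact (Measure.prod_apply hS).symm.trans (Measure.prod_apply_symm hS)
  have hmeas : Measurable fun z : ℝ => ENNReal.ofReal (min z A ^ β) := by fun_prop
  rw [e1, ← lintegral_const_mul _ hmeas]
  refine setLIntegral_mono' measurableSet_Ioi fun z hz => ?_
  have hz0 : (0 : ℝ) < z := hz
  have hm : 0 < min z A := lt_min hz0 hA
  rw [Measure.restrict_apply' hT]
  calc μ ({x | r / g x < z} ∩ {x | r / A < g x}) ≤ μ {x | r / min z A < g x} := by
        refine measure_mono ?_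
        rintro x ⟨h1, h2⟩
        simp only [mem_ofPred_eq] at h1 h2 ⊢
        have hgx : 0 < g x := lt_trans (by positivity) h2
        rcases min_choice z A with h | h <;> rw [h]
        · rw [div_lt_iff₀ hgx] at h1
          rw [div_lt_iff₀ hz0]
          linarith
        · exact h2
    _ ≤ ENNReal.ofReal (C * (r / min z A) ^ (-β)) := hμ _ (by positivity)
    _ = _ := by
        rw [← ENNReal.ofReal_mul (by positivity), Real.div_rpow hr.le hm.le,
          Real.rpow_neg hm.le, div_inv_eq_mul, mul_assoc]

theorem tendsto_lintegral_measure_Ioi_div {X : Type*} [MeasurableSpace X] {μ : Measure X}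
    [SFinite μ] {lam : Measure ℝ} [SFinite lam] (hlam0 : lam (Iic 0) = 0)
    {g : X → ℝ} (hg : Measurable g) (hg0 : ∀ᵐ x ∂μ, 0 < g x)
    {α β C : ℝ} (hα : 0 < α) (hαβ : α < β) (hC : 0 ≤ C)
    (hμ : ∀ u > 0, μ {x | u < g x} ≤ ENNReal.ofReal (C * u ^ (-β)))
    (hmom : ∀ p, 0 < p → p < β → ∫⁻ x, ENNReal.ofReal (g x ^ p) ∂μ ≠ ∞)
    (hpos : ∀ r ≥ (1 : ℝ), 0 < (lam (Ioi r)).toReal)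
    (hreg : ∀ c > (0 : ℝ), Tendsto (fun r => (lam (Ioi (c * r))).toReal / (lam (Ioi r)).toReal)
      atTop (𝓝 (c ^ (-α))))
    (hsmall : ∫⁻ z in Ioc (0 : ℝ) 1, ENNReal.ofReal (z ^ β) ∂lam ≠ ∞) :
    Tendsto (fun r => (∫⁻ x, lam (Ioi (r / g x)) ∂μ) / lam (Ioi r)) atTop
      (𝓝 (∫⁻ x, ENNReal.ofReal (g x ^ α) ∂μ)) := by
  have hfin : ∀ r ≥ (1 : ℝ), lam (Ioi r) ≠ ∞ := fun r hr =>
    (ENNReal.toReal_pos_iff.1 (hpos r hr)).2.ne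
  have hanti : AntitoneOn (fun r => (lam (Ioi r)).toReal) (Ici 1) := fun x hx y _ hxy =>
    ENNReal.toReal_mono (hfin x hx) (measure_mono (Ioi_subset_Ioi hxy))
  have hratio : ∀ x ≥ (1 : ℝ), ∀ y ≥ (1 : ℝ), lam (Ioi y) / lam (Ioi x) =
      ENNReal.ofReal ((lam (Ioi y)).toReal / (lam (Ioi x)).toReal) := fun x hx y hy => by
    rw [ENNReal.ofReal_div_of_pos (hpos x hx), ENNReal.ofReal_toReal (hfin x hx),
      ENNReal.ofReal_toReal (hfin y hy)]
  obtain ⟨δ, hδ, hδα, hδβ⟩ : ∃ δ, 0 < δ ∧ δ < α ∧ α + δ < β :=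
    ⟨min α (β - α) / 2, by have := lt_min hα (sub_pos.2 hαβ); linarith,
      by have := min_le_left α (β - α); linarith,
      by have := min_le_right α (β - α); linarith⟩
  obtain ⟨A, hA1, hA⟩ := potter_bound hδ hδα hanti hpos (hreg 2 (by norm_num))
  have hA0 : 0 < A := by linarith
  have hmG : ∀ r, Measurable fun x => lam (Ioi (r / g x)) := fun r =>
    (measurable_measure_Ioi lam).comp (measurable_const.div hg)
  have hmS : ∀ r, MeasurableSet {x | g x ≤ r / A} := fun r =>
    measurableSet_le hg measurable_const
  have hbulk : Tendsto (fun r => ∫⁻ x, {x | g x ≤ r / A}.indicator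
      (fun x => lam (Ioi (r / g x)) / lam (Ioi r)) x ∂μ) atTop
      (𝓝 (∫⁻ x, ENNReal.ofReal (g x ^ α) ∂μ)) := by
    refine tendsto_lintegral_filter_of_dominated_convergence
      (fun x => ENNReal.ofReal (2 ^ (α + δ)) *
        (ENNReal.ofReal (g x ^ (α - δ)) + ENNReal.ofReal (g x ^ (α + δ))))
      (Eventually.of_forall fun r => ((hmG r).div_const _).indicator (hmS r)) ?_ ?_ ?_
    · filter_upwards [eventually_ge_atTop A] with r hr
      filter_upwards [hg0] with x hx
      by_cases hxr : g x ≤ r / A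
      · have hr0 : 0 < r := by linarith
        have hy : A ≤ r / g x := by
          rw [le_div_iff₀ hA0] at hxr
          rw [le_div_iff₀ hx]
          linarith
        rw [indicator_of_mem (by exact hxr), hratio r (hA1.trans hr) _ (hA1.trans hy),
          ← ENNReal.ofReal_add (by positivity) (by positivity),
          ← ENNReal.ofReal_mul (by positivity)]
        refine ENNReal.ofReal_le_ofReal ?_
        rw [div_le_iff₀ (hpos r (hA1.trans hr))]
        have h := hA r hr _ hy
        rw [div_div_cancel₀ hr0.ne'] at h
        calc _ ≤ _ := h
          _ = _ := by ring
      · rw [indicator_of_notMem (by exact hxr)]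
        exact zero_le
    · rw [lintegral_const_mul _ (by fun_prop), lintegral_add_left (by fun_prop)]
      exact ENNReal.mul_ne_top ENNReal.ofReal_ne_top (ENNReal.add_ne_top.2
        ⟨hmom _ (by linarith) (by linarith), hmom _ (by linarith) hδβ⟩)
    · filter_upwards [hg0] with x hx
      have h := ENNReal.tendsto_ofReal (hreg (g x)⁻¹ (inv_pos.2 hx))
      rw [Real.inv_rpow hx.le, Real.rpow_neg hx.le, inv_inv] at h
      refine h.congr' ?_
      filter_upwards [eventually_ge_atTop A, eventually_ge_atTop (g x * A)] with r hr hr2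
      have hxr : g x ≤ r / A := (le_div_iff₀ hA0).2 hr2
      have hy : A ≤ r / g x := by
        rw [le_div_iff₀ hx]
        linarith
      rw [indicator_of_mem (by exact hxr), hratio r (hA1.trans hr) _ (hA1.trans hy),
        inv_mul_eq_div]
  have hK : ∫⁻ z in Ioi (0 : ℝ), ENNReal.ofReal (min z A ^ β) ∂lam ≠ ∞ := by
    rw [← Ioc_union_Ioi_eq_Ioi (zero_le_one' ℝ)]
    refine ne_top_of_le_ne_top (ENNReal.add_ne_top.2 ⟨hsmall, ?_⟩)
      ((lintegral_union_le _ _ _).trans (add_le_add (setLIntegral_mono' measurableSet_Ioc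
        fun z hz => ?_) (setLIntegral_mono' (g := fun _ => ENNReal.ofReal (A ^ β))
          measurableSet_Ioi fun z hz => ?_)))
    · rw [setLIntegral_const]
      exact ENNReal.mul_ne_top ENNReal.ofReal_ne_top (hfin 1 le_rfl)
    · rw [min_eq_left (hz.2.trans hA1)]
    · have hz0 : (1 : ℝ) < z := hz
      exact ENNReal.ofReal_le_ofReal (Real.rpow_le_rpow
        (le_min (by linarith) hA0.le) (min_le_right _ _) (by linarith))
  set K := ∫⁻ z in Ioi (0 : ℝ), ENNReal.ofReal (min z A ^ β) ∂lam
  have hdecay : Tendsto (fun r => r ^ (-β) / (lam (Ioi r)).toReal) atTop (𝓝 0) := by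
    have hFA := hpos A hA1
    set B := 2 ^ (α + δ) * (A ^ (-(α - δ)) + A ^ (-(α + δ))) / (lam (Ioi A)).toReal with hB
    have hlim : Tendsto (fun r : ℝ => B * r ^ (-(β - (α + δ)))) atTop (𝓝 0) := by
      simpa using (tendsto_rpow_neg_atTop (sub_pos.2 hδβ)).const_mul B
    refine tendsto_of_tendsto_of_tendsto_of_le_of_le' tendsto_const_nhds hlim ?_ ?_
    · filter_upwards [eventually_ge_atTop 0] with r hr
      positivity
    · filter_upwards [eventually_ge_atTop A] with r hr
      have hr0 : 0 < r := by linarith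
      have hFr := hpos r (hA1.trans hr)
      have h := hA r hr A le_rfl
      rw [Real.div_rpow hr0.le hA0.le, Real.div_rpow hr0.le hA0.le] at h
      have hle : r ^ (α - δ) ≤ r ^ (α + δ) :=
        Real.rpow_le_rpow_of_exponent_le (hA1.trans hr) (by linarith)
      have h2 : (lam (Ioi A)).toReal ≤ 2 ^ (α + δ) * (lam (Ioi r)).toReal *
          (r ^ (α + δ) / A ^ (α - δ) + r ^ (α + δ) / A ^ (α + δ)) := by
        refine h.trans ?_
        gcongr
      have h3 : 1 ≤ B * r ^ (α + δ) * (lam (Ioi r)).toReal := by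
        rw [hB, Real.rpow_neg hA0.le, Real.rpow_neg hA0.le, div_mul_eq_mul_div,
          div_mul_eq_mul_div, le_div_iff₀ hFA, one_mul]
        refine h2.trans (le_of_eq ?_)
        ring
      rw [div_le_iff₀ hFr, neg_sub, sub_eq_add_neg, Real.rpow_add hr0]
      have hrb : 0 < r ^ (-β) := by positivity
      nlinarith
  have htail : Tendsto (fun r => (∫⁻ x in {x | r / A < g x}, lam (Ioi (r / g x)) ∂μ) /
      lam (Ioi r)) atTop (𝓝 0) := by
    have hlim : Tendsto (fun r => ENNReal.ofReal (C * (r ^ (-β) / (lam (Ioi r)).toReal)) * K)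
        atTop (𝓝 0) := by
      have h := ENNReal.Tendsto.mul_const (b := K)
        (ENNReal.tendsto_ofReal (hdecay.const_mul C)) (Or.inr hK)
      simpa using h
    refine tendsto_of_tendsto_of_tendsto_of_le_of_le' tendsto_const_nhds hlim
      (Eventually.of_forall fun _ => zero_le) ?_
    filter_upwards [eventually_ge_atTop 1] with r hr
    calc _ ≤ ENNReal.ofReal (C * r ^ (-β)) * K / lam (Ioi r) := by
          gcongr
          exact lintegral_measure_Ioi_div_le hlam0 hg hC hA0 (by linarith) hμ
      _ = _ := by
          rw [← mul_div_assoc, ENNReal.ofReal_div_of_pos (hpos r hr),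
            ENNReal.ofReal_toReal (hfin r hr), ENNReal.mul_div_right_comm]
  have hsum := hbulk.add htail
  rw [add_zero] at hsum
  refine hsum.congr fun r => ?_
  have hc : {x | g x ≤ r / A}ᶜ = {x | r / A < g x} := by
    ext
    simp
  rw [lintegral_indicator (hmS r), 
    ← lintegral_add_compl (μ := μ) (fun x => lam (Ioi (r / g x))) (hmS r), hc,
    ENNReal.add_div]
  congr 1
  simp_rw [ENNReal.div_eq_inv_mul]
  rw [lintegral_const_mul _ (hmG r)]

theorem heatKernel_pos {d : ℕ} {κ s : ℝ} (hκ : 0 < κ) (hs : 0 < s)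
    (y : EuclideanSpace ℝ (Fin d)) : 0 < heatKernel d κ s y := by
  unfold heatKernel
  positivity

theorem measurable_heatKernel (d : ℕ) (κ : ℝ) :
    Measurable fun p : ℝ × EuclideanSpace ℝ (Fin d) => heatKernel d κ p.1 p.2 := by
  unfold heatKernel
  fun_prop

theorem lintegral_heatKernel_rpow {d : ℕ} {κ s p : ℝ} (hκ : 0 < κ) (hs : 0 < s) (hp : 0 < p) :
    ∫⁻ y, ENNReal.ofReal (heatKernel d κ s y ^ p) =
      ENNReal.ofReal ((2 * π * κ * s) ^ ((d : ℝ) / 2 * (1 - p)) * p ^ (-((d : ℝ) / 2))) := by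
  have hπ := Real.pi_pos
  have hb : 0 < p / (2 * κ * s) := by positivity
  have hc : 0 < 2 * π * κ * s := by positivity
  have hval : ∫ y : EuclideanSpace ℝ (Fin d), Real.exp (-(p / (2 * κ * s)) * ‖y‖ ^ 2) =
      (2 * π * κ * s / p) ^ ((d : ℝ) / 2) := by
    rw [GaussianFourier.integral_rexp_neg_mul_sq_norm hb, finrank_euclideanSpace_fin]
    congr 1
    field_simp
  have hinteg : Integrable fun y : EuclideanSpace ℝ (Fin d) =>
      Real.exp (-(p / (2 * κ * s)) * ‖y‖ ^ 2) := by
    by_contra h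
    rw [integral_undef h] at hval
    have : 0 < (2 * π * κ * s / p) ^ ((d : ℝ) / 2) := by positivity
    linarith
  have hfun : ∀ y : EuclideanSpace ℝ (Fin d), ENNReal.ofReal (heatKernel d κ s y ^ p) =
      ENNReal.ofReal ((2 * π * κ * s) ^ (-(d : ℝ) / 2 * p)) *
        ENNReal.ofReal (Real.exp (-(p / (2 * κ * s)) * ‖y‖ ^ 2)) := fun y => by
    rw [← ENNReal.ofReal_mul (by positivity), heatKernel,
      Real.mul_rpow (by positivity) (Real.exp_pos _).le, ← Real.rpow_mul hc.le, ← Real.exp_mul]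
    congr 3
    field_simp
  simp_rw [hfun]
  rw [lintegral_const_mul' _ _ ENNReal.ofReal_ne_top,
    ← ofReal_integral_eq_lintegral_ofReal hinteg (Eventually.of_forall fun _ => (Real.exp_pos _).le),
    hval, ← ENNReal.ofReal_mul (by positivity), Real.div_rpow hc.le hp.le, Real.rpow_neg hp.le,
    ← mul_div_assoc, ← Real.rpow_add hc, ← div_eq_mul_inv]
  congr 3
  ring

theorem lintegral_prod_heatKernel_rpow {d : ℕ} {κ t p : ℝ} (hd : 1 ≤ d) (hκ : 0 < κ) (ht : 0 < t)
    (hp : 0 < p) (hp' : p < 1 + 2 / (d : ℝ)) :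
    ∫⁻ x : ℝ × EuclideanSpace ℝ (Fin d), ENNReal.ofReal (heatKernel d κ x.1 x.2 ^ p)
        ∂((volume.restrict (Ioc 0 t)).prod volume) =
      ENNReal.ofReal ((2 * π * κ) ^ ((d : ℝ) / 2 * (1 - p)) * p ^ (-((d : ℝ) / 2)) *
        (t ^ ((d : ℝ) / 2 * (1 - p) + 1) / ((d : ℝ) / 2 * (1 - p) + 1))) := by
  have hπ := Real.pi_pos
  have hd0 : (0 : ℝ) < d := by exact_mod_cast hd
  have hq : -1 < (d : ℝ) / 2 * (1 - p) := by
    have h : (d : ℝ) / 2 * p < d / 2 * (1 + 2 / d) := by gcongr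
    have h2 : (d : ℝ) / 2 * (1 + 2 / d) = d / 2 + 1 := by field_simp
    linarith
  set q := (d : ℝ) / 2 * (1 - p)
  have hinteg : IntegrableOn (fun s : ℝ => s ^ q) (Ioc 0 t) :=
    (intervalIntegrable_iff_integrableOn_Ioc_of_le ht.le).1
      (intervalIntegral.intervalIntegrable_rpow' hq)
  have hval : ∫⁻ s in Ioc 0 t, ENNReal.ofReal (s ^ q) = ENNReal.ofReal (t ^ (q + 1) / (q + 1)) := by
    rw [← ofReal_integral_eq_lintegral_ofReal hinteg
      ((ae_restrict_mem measurableSet_Ioc).mono fun s hs => Real.rpow_nonneg hs.1.le q),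
      ← intervalIntegral.integral_of_le ht.le, integral_rpow (Or.inl hq),
      Real.zero_rpow (by linarith), sub_zero]
  rw [lintegral_prod _ ((measurable_heatKernel d κ).pow_const p).ennreal_ofReal.aemeasurable]
  have hpt : ∀ s ∈ Ioc 0 t, ∫⁻ y, ENNReal.ofReal (heatKernel d κ s y ^ p) =
      ENNReal.ofReal ((2 * π * κ) ^ q * p ^ (-((d : ℝ) / 2))) * ENNReal.ofReal (s ^ q) := by
    intro s hs
    rw [lintegral_heatKernel_rpow hκ hs.1 hp, ← ENNReal.ofReal_mul (by positivity),
      Real.mul_rpow (by positivity) hs.1.le]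
    congr 1
    ring
  rw [setLIntegral_congr_fun measurableSet_Ioc hpt, lintegral_const_mul' _ _ ENNReal.ofReal_ne_top,
    hval, ← ENNReal.ofReal_mul (by positivity)]

theorem measure_lt_heatKernel_le {d : ℕ} {κ t u : ℝ} (hd : 1 ≤ d) (hκ : 0 < κ) (hu : 0 < u) :
    ((volume.restrict (Ioc 0 t)).prod volume)
        {x : ℝ × EuclideanSpace ℝ (Fin d) | u < heatKernel d κ x.1 x.2} ≤
      ENNReal.ofReal ((2 * π * κ)⁻¹ * u ^ (-(1 + 2 / (d : ℝ)))) := by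
  have hπ := Real.pi_pos
  have hd0 : (0 : ℝ) < d := by exact_mod_cast hd
  set v := (2 * π * κ)⁻¹ * u ^ (-(2 / (d : ℝ))) with hv
  have hv0 : 0 < v := by positivity
  rw [Measure.prod_apply (measurableSet_lt measurable_const (measurable_heatKernel d κ))]
  have hslice : ∀ s ∈ Ioc 0 t, volume (Prod.mk s ⁻¹'
      {x : ℝ × EuclideanSpace ℝ (Fin d) | u < heatKernel d κ x.1 x.2}) ≤
      (Ioc 0 v).indicator (fun _ => ENNReal.ofReal u⁻¹) s := by
    intro s hs
    have hs0 := hs.1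
    have hc : 0 < 2 * π * κ * s := by positivity
    by_cases hsv : s ≤ v
    · rw [indicator_of_mem (show s ∈ Ioc 0 v from ⟨hs0, hsv⟩)]
      have hone : ∫⁻ y, ENNReal.ofReal (heatKernel d κ s y) = 1 := by
        simpa using lintegral_heatKernel_rpow (d := d) hκ hs0 one_pos
      have hmk := mul_meas_ge_le_lintegral (μ := volume)
        ((measurable_heatKernel d κ).comp measurable_prodMk_left).ennreal_ofReal
        (ENNReal.ofReal u) (f := fun y => ENNReal.ofReal (heatKernel d κ s y))
      rw [hone, mul_comm, ← ENNReal.le_div_iff_mul_le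
        (Or.inl (ENNReal.ofReal_pos.2 hu).ne') (Or.inl ENNReal.ofReal_ne_top), one_div,
        ← ENNReal.ofReal_inv_of_pos hu] at hmk
      refine (measure_mono fun y hy => ?_).trans hmk
      exact ENNReal.ofReal_le_ofReal (le_of_lt hy)
    · rw [indicator_of_notMem fun h => hsv h.2]
      refine (measure_mono_null (fun y (hy : u < heatKernel d κ s y) => hsv ?_)
        measure_empty).le
      have h1 : heatKernel d κ s y ≤ (2 * π * κ * s) ^ (-(d : ℝ) / 2) := by
        refine mul_le_of_le_one_right (by positivity) (Real.exp_le_one_iff.2 ?_)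
        exact div_nonpos_of_nonpos_of_nonneg (neg_nonpos.2 (by positivity)) (by positivity)
      have h2 : u < (2 * π * κ * s) ^ (-(d : ℝ) / 2) := hy.trans_le h1
      have h3 := Real.rpow_le_rpow_of_nonpos hu h2.le
        (neg_nonpos.2 (by positivity : 0 ≤ 2 / (d : ℝ)))
      rw [← Real.rpow_mul hc.le, show -(d : ℝ) / 2 * -(2 / d) = 1 by field_simp, Real.rpow_one]
        at h3
      rw [hv, inv_mul_eq_div, le_div_iff₀ (by positivity)]
      linarith
  calc _ ≤ ∫⁻ s in Ioc 0 t, (Ioc 0 v).indicator (fun _ => ENNReal.ofReal u⁻¹) s :=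
        setLIntegral_mono' measurableSet_Ioc hslice
    _ ≤ ∫⁻ s, (Ioc 0 v).indicator (fun _ => ENNReal.ofReal u⁻¹) s := setLIntegral_le_lintegral _ _
    _ = _ := by
      rw [lintegral_indicator measurableSet_Ioc, setLIntegral_const, Real.volume_Ioc, sub_zero,
        ← ENNReal.ofReal_mul (by positivity), hv, neg_add, Real.rpow_add hu, Real.rpow_neg_one]
      congr 1
      ring

theorem etaBar_eq_lintegral {d : ℕ} {κ t r : ℝ} {lam : Measure ℝ} [SFinite lam] (hκ : 0 < κ)
    (hr : 0 < r) :
    etaBar d κ t lam r = ∫⁻ x : ℝ × EuclideanSpace ℝ (Fin d),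
      lam (Ioi (r / heatKernel d κ x.1 x.2)) ∂((volume.restrict (Ioc 0 t)).prod volume) := by
  have hg := measurable_heatKernel d κ
  have hG : Measurable fun p : ℝ × EuclideanSpace ℝ (Fin d) × ℝ =>
      heatKernel d κ p.1 p.2.1 :=
    hg.comp (measurable_fst.prodMk (measurable_fst.comp measurable_snd))
  have hz : Measurable fun p : ℝ × EuclideanSpace ℝ (Fin d) × ℝ => p.2.2 :=
    measurable_snd.comp measurable_snd
  have hS : MeasurableSet {p : ℝ × (EuclideanSpace ℝ (Fin d)) × ℝ |
      p.1 ∈ Set.Ioc (0 : ℝ) t ∧ p.2.2 ∈ Set.Ioi (0 : ℝ) ∧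
        r < heatKernel d κ p.1 p.2.1 * p.2.2} :=
    (measurable_fst measurableSet_Ioc).inter
      ((hz measurableSet_Ioi).inter (measurableSet_lt measurable_const (hG.mul hz)))
  have hF : Measurable fun x : ℝ × EuclideanSpace ℝ (Fin d) =>
      lam (Ioi (r / heatKernel d κ x.1 x.2)) :=
    (measurable_measure_Ioi lam).comp (measurable_const.div hg)
  rw [etaBar, Measure.prod_apply hS, lintegral_prod _ hF.aemeasurable,
    ← lintegral_indicator measurableSet_Ioc]
  refine lintegral_congr fun s => ?_
  by_cases hs : s ∈ Ioc 0 t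
  · rw [indicator_of_mem hs, Measure.prod_apply (measurable_prodMk_left hS)]
    refine lintegral_congr fun y => ?_
    congr 1
    ext z
    have hpos := heatKernel_pos hκ hs.1 y
    simp only [mem_preimage, mem_ofPred_eq, hs, true_and, mem_Ioi, div_lt_iff₀' hpos]
    exact ⟨fun h => h.2, fun h => ⟨pos_of_mul_pos_right (hr.trans h) hpos.le, h⟩⟩
  · rw [indicator_of_notMem hs]
    exact measure_mono_null (fun y hy => hs hy.1) measure_empty

theorem IsLevyMeasure.sigmaFinite {lam : Measure ℝ} (h : IsLevyMeasure lam) : SigmaFinite lam := by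
  obtain ⟨-, h0, hinteg⟩ := h
  have hfin : ∀ n : ℕ, lam (Iic 0 ∪ Ioi (1 / ((n : ℝ) + 1))) < ∞ := by
    intro n
    have hε : (0 : ℝ) < 1 / ((n : ℝ) + 1) := by positivity
    have hε1 : 1 / ((n : ℝ) + 1) ≤ 1 := by
      rw [div_le_one (by positivity)]
      linarith [n.cast_nonneg (α := ℝ)]
    set ε := 1 / ((n : ℝ) + 1)
    refine (measure_union_le _ _).trans_lt ?_
    rw [h0, zero_add]
    have hle : ENNReal.ofReal (ε ^ 2) * lam (Ioi ε) ≤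
        ∫⁻ z in Ioi (0 : ℝ), ENNReal.ofReal (min 1 (z ^ 2)) ∂lam := by
      rw [← setLIntegral_const]
      refine (setLIntegral_mono' measurableSet_Ioi fun z (hz : ε < z) => ?_).trans
        (lintegral_mono_set (Ioi_subset_Ioi hε.le))
      refine ENNReal.ofReal_le_ofReal (le_min ?_ ?_)
      · nlinarith
      · nlinarith
    have hpos : ENNReal.ofReal (ε ^ 2) ≠ 0 := (ENNReal.ofReal_pos.2 (by positivity)).ne'
    by_contra htop
    rw [not_lt, top_le_iff] at htop
    rw [htop, ENNReal.mul_top hpos, top_le_iff] at hle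
    exact hinteg.ne hle
  refine Measure.FiniteSpanningSetsIn.sigmaFinite (C := univ)
    ⟨fun n : ℕ => Iic 0 ∪ Ioi (1 / ((n : ℝ) + 1)), fun _ => mem_univ _, hfin, ?_⟩
  refine eq_univ_of_forall fun z => mem_iUnion.2 ?_
  rcases le_or_gt z 0 with hz | hz
  · exact ⟨0, Or.inl hz⟩
  · obtain ⟨n, hn⟩ := exists_nat_one_div_lt hz
    exact ⟨n, Or.inr hn⟩

theorem ConditionE.lintegral_rpow_ne_top {d : ℕ} (hd : 1 ≤ d) {lam : Measure ℝ}
    (hlam : IsLevyMeasure lam) (hE : ConditionE d lam) :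
    ∫⁻ z in Ioc (0 : ℝ) 1, ENNReal.ofReal (z ^ (1 + 2 / (d : ℝ))) ∂lam ≠ ∞ := by
  rcases le_or_gt 3 d with h3 | h3
  · exact (hE.2.2.2 h3).ne
  · refine ne_top_of_le_ne_top hlam.2.2.ne ((setLIntegral_mono' measurableSet_Ioc
      fun z hz => ?_).trans (lintegral_mono_set Ioc_subset_Ioi_self))
    have hd0 : (0 : ℝ) < d := by exact_mod_cast hd
    have hd2 : (d : ℝ) ≤ 2 := by exact_mod_cast Nat.le_of_lt_succ h3
    have hβ : (2 : ℝ) ≤ 1 + 2 / d := by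
      have : 1 ≤ 2 / (d : ℝ) := (one_le_div hd0).2 hd2
      linarith
    have hz2 : z ^ 2 ≤ 1 := pow_le_one₀ hz.1.le hz.2
    rw [min_eq_right hz2, ← Real.rpow_two]
    exact ENNReal.ofReal_le_ofReal (Real.rpow_le_rpow_of_exponent_ge hz.1 hz.2 hβ)

/-- Lemma 2.2 (ii), case `α < 1 + 2/d`: if `λ̄(r) = ℓ(r) r^{-α}` with `ℓ` slowly varying,
then `η̄(r) ~ ℓ(r) r^{-α} D^{1+2/d-α}/(dπκ α^{d/2} (1+2/d-α))` as `r → ∞`. -/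
theorem stmt_4 (d : ℕ) (hd : 1 ≤ d) (κ t : ℝ) (hκ : 0 < κ) (ht : 0 < t)
    (lam : Measure ℝ) (hlam : IsLevyMeasure lam) (hE : ConditionE d lam)
    (α : ℝ) (hα0 : 0 < α) (hα1 : α < 1 + 2 / (d : ℝ))
    (ℓ : ℝ → ℝ) (hℓ : SlowlyVarying ℓ)
    (hrep : ∀ r ≥ (1 : ℝ), (lam (Set.Ioi r)).toReal = ℓ r * r ^ (-α))
    (D : ℝ) (hD : D = (2 * π * κ * t) ^ ((d : ℝ) / 2)) :
    Tendsto (fun r : ℝ =>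
        (etaBar d κ t lam r).toReal /
          (ℓ r * r ^ (-α) *
            (D ^ (1 + 2 / (d : ℝ) - α) /
              ((d : ℝ) * π * κ * α ^ ((d : ℝ) / 2) * (1 + 2 / (d : ℝ) - α)))))
      atTop (𝓝 1) := by
  have hπ := Real.pi_pos
  have hd0 : (0 : ℝ) < d := by exact_mod_cast hd
  have := hlam.sigmaFinite
  obtain ⟨-, hℓ0, hℓ⟩ := hℓ
  have hpos : ∀ r ≥ (1 : ℝ), 0 < (lam (Ioi r)).toReal := fun r hr => by
    have := hℓ0 r hr
    rw [hrep r hr]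
    positivity
  have hreg : ∀ c > (0 : ℝ), Tendsto
      (fun r => (lam (Ioi (c * r))).toReal / (lam (Ioi r)).toReal) atTop (𝓝 (c ^ (-α))) := by
    intro c hc
    have h := (hℓ c hc).mul_const (c ^ (-α))
    rw [one_mul] at h
    refine h.congr' ?_
    filter_upwards [eventually_ge_atTop 1, eventually_ge_atTop (1 / c)] with r hr hr2
    have hr0 : 0 < r := by linarith
    have hcr : 1 ≤ c * r := by
      rwa [div_le_iff₀' hc] at hr2
    have hrα : 0 < r ^ (-α) := by positivity
    rw [hrep r hr, hrep _ hcr, Real.mul_rpow hc.le hr0.le]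
    field_simp
  have hg0 : ∀ᵐ x : ℝ × EuclideanSpace ℝ (Fin d) ∂((volume.restrict (Ioc 0 t)).prod volume),
      0 < heatKernel d κ x.1 x.2 := by
    have h : ∀ᵐ s ∂(volume.restrict (Ioc 0 t)), s ∈ Ioc 0 t := ae_restrict_mem measurableSet_Ioc
    filter_upwards [Measure.quasiMeasurePreserving_fst.ae h] with x hx
    exact heatKernel_pos hκ hx.1 x.2
  have key := tendsto_lintegral_measure_Ioi_div hlam.2.1 (measurable_heatKernel d κ) hg0 hα0 hα1
    (inv_nonneg.2 (by positivity)) (fun u hu => measure_lt_heatKernel_le hd hκ hu)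
    (fun p hp hp' => by
      rw [lintegral_prod_heatKernel_rpow hd hκ ht hp hp']
      exact ENNReal.ofReal_ne_top)
    hpos hreg (hE.lintegral_rpow_ne_top hd hlam)
  rw [lintegral_prod_heatKernel_rpow hd hκ ht hα0 hα1] at key
  have hβ : 0 < 1 + 2 / (d : ℝ) - α := by linarith
  have hq : (d : ℝ) / 2 * (1 - α) + 1 = d / 2 * (1 + 2 / d - α) := by
    field_simp
    ring
  have hconst : (2 * π * κ) ^ ((d : ℝ) / 2 * (1 - α)) * α ^ (-((d : ℝ) / 2)) *
      (t ^ ((d : ℝ) / 2 * (1 - α) + 1) / ((d : ℝ) / 2 * (1 - α) + 1)) =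
      D ^ (1 + 2 / (d : ℝ) - α) /
        ((d : ℝ) * π * κ * α ^ ((d : ℝ) / 2) * (1 + 2 / (d : ℝ) - α)) := by
    have hc : 0 < 2 * π * κ := by positivity
    rw [hD, ← Real.rpow_mul (by positivity), ← hq, Real.mul_rpow hc.le ht.le,
      Real.rpow_add hc, Real.rpow_one, Real.rpow_neg hα0.le, hq]
    field_simp
  rw [hconst] at key
  have hDpos : 0 < D := by
    rw [hD]
    positivity
  set c := D ^ (1 + 2 / (d : ℝ) - α) /
    ((d : ℝ) * π * κ * α ^ ((d : ℝ) / 2) * (1 + 2 / (d : ℝ) - α))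
  have hc0 : 0 < c := by positivity
  have hlim := ((ENNReal.tendsto_toReal ENNReal.ofReal_ne_top).comp key).div_const c
  rw [ENNReal.toReal_ofReal hc0.le, div_self hc0.ne'] at hlim
  refine hlim.congr' ?_
  filter_upwards [eventually_ge_atTop 1] with r hr
  rw [Function.comp_apply, ← etaBar_eq_lintegral hκ (by linarith), ENNReal.toReal_div, hrep r hr,
    div_div]
end
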